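/- Let δ ≥ 1 be an integer. The cyclic polytope C(δ+2, δ) has exactly two triangulations, namely its lower triangulation and its upper triangulation, and these two triangulations are distinct. -/

import Mathlib

open Finset

noncomputable section

/-- The moment curve `p_δ(t) = (t, t², …, t^δ)` in `ℝ^δ`. -/
def momCurve (δ : ℕ) (t : ℝ) : Fin δ → ℝ := fun i => t ^ (i.1 + 1)

/-- The points `p_δ(a)` on the moment curve for `a` ranging over a finite set of naturals. -/
def momPts (δ : ℕ) (A : Finset ℕ) : Set (Fin δ → ℝ) :=
  (fun a : ℕ => momCurve δ (a : ℝ)) '' (A : Set ℕ)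

/-- The simplex `|A|_δ`, i.e. the convex hull of the points `p_δ(a)`, `a ∈ A`. -/
def smp (δ : ℕ) (A : Finset ℕ) : Set (Fin δ → ℝ) := convexHull ℝ (momPts δ A)

/-- The cyclic polytope `C(m, δ) = conv{p_δ(1), …, p_δ(m)}`. -/
def cyc (m δ : ℕ) : Set (Fin δ → ℝ) := smp δ (Finset.Icc 1 m)

/-- The last standard basis vector `e_δ` of `ℝ^δ`. -/
def eLast (δ : ℕ) : Fin δ → ℝ := fun i => if i.1 = δ - 1 then 1 else 0

/-- The last coordinate of a point of `ℝ^δ`. -/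
def lastCoord {δ : ℕ} (x : Fin δ → ℝ) : ℝ :=
  if h : 0 < δ then x ⟨δ - 1, Nat.sub_lt h one_pos⟩ else 0

/-- `x` lies strictly above `V`: `x - r • e_δ ∈ V` for some `r > 0`. -/
def StrictlyAbove {δ : ℕ} (x : Fin δ → ℝ) (V : Set (Fin δ → ℝ)) : Prop :=
  ∃ r : ℝ, 0 < r ∧ x - r • eLast δ ∈ V

/-- `x` lies strictly below `V`: `x - r • e_δ ∈ V` for some `r < 0`. -/
def StrictlyBelow {δ : ℕ} (x : Fin δ → ℝ) (V : Set (Fin δ → ℝ)) : Prop :=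
  ∃ r : ℝ, r < 0 ∧ x - r • eLast δ ∈ V

/-- `|F|_δ` is a lower facet of the cyclic polytope `C(m, δ)`. -/
def IsLowerFacet (m δ : ℕ) (F : Finset ℕ) : Prop :=
  F ⊆ Finset.Icc 1 m ∧ F.card = δ ∧
    ∀ i ∈ Finset.Icc 1 m, i ∉ F →
      StrictlyAbove (momCurve δ (i : ℝ))
        ((affineSpan ℝ (momPts δ F) : AffineSubspace ℝ (Fin δ → ℝ)) : Set (Fin δ → ℝ))

/-- `|F|_δ` is an upper facet of the cyclic polytope `C(m, δ)`. -/
def IsUpperFacet (m δ : ℕ) (F : Finset ℕ) : Prop :=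
  F ⊆ Finset.Icc 1 m ∧ F.card = δ ∧
    ∀ i ∈ Finset.Icc 1 m, i ∉ F →
      StrictlyBelow (momCurve δ (i : ℝ))
        ((affineSpan ℝ (momPts δ F) : AffineSubspace ℝ (Fin δ → ℝ)) : Set (Fin δ → ℝ))

/-- The facet `|H ∖ {c}|_δ` of the simplex `|H|_δ` is a lower facet of `|H|_δ`. -/
def IsLowerFacetOfSimplex (δ : ℕ) (H : Finset ℕ) (c : ℕ) : Prop :=
  c ∈ H ∧ StrictlyAbove (momCurve δ (c : ℝ))
    ((affineSpan ℝ (momPts δ (H.erase c)) : AffineSubspace ℝ (Fin δ → ℝ)) : Set (Fin δ → ℝ))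

/-- The facet `|H ∖ {c}|_δ` of the simplex `|H|_δ` is an upper facet of `|H|_δ`. -/
def IsUpperFacetOfSimplex (δ : ℕ) (H : Finset ℕ) (c : ℕ) : Prop :=
  c ∈ H ∧ StrictlyBelow (momCurve δ (c : ℝ))
    ((affineSpan ℝ (momPts δ (H.erase c)) : AffineSubspace ℝ (Fin δ → ℝ)) : Set (Fin δ → ℝ))

/-- `T` is a triangulation of the cyclic polytope `C(m, δ)`. -/
def IsTriangulation (m δ : ℕ) (T : Finset (Finset ℕ)) : Prop :=
  (∀ S ∈ T, S ⊆ Finset.Icc 1 m ∧ S.card = δ + 1) ∧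
  (⋃ S ∈ T, smp δ S) = cyc m δ ∧
  ∀ S ∈ T, ∀ S' ∈ T, smp δ S ∩ smp δ S' = smp δ (S ∩ S')

/-- `A` is a face of the triangulation `T`. -/
def IsFace (T : Finset (Finset ℕ)) (A : Finset ℕ) : Prop := ∃ S ∈ T, A ⊆ S

/-- `A ≀ B`: writing `A = {a_0 < … < a_d}` and `B = {b_0 < … < b_d}`, we have
`a_0 < b_0 < a_1 < b_1 < … < a_d < b_d`. -/
def Intertwines (d : ℕ) (A B : Finset ℕ) : Prop :=
  ∃ a b : Fin (d + 1) → ℕ, StrictMono a ∧ StrictMono b ∧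
    A = Finset.image a Finset.univ ∧ B = Finset.image b Finset.univ ∧
    (∀ i, a i < b i) ∧ ∀ i : Fin d, b i.castSucc < a i.succ

/-- `y = ℓ_S(x)` is the lift of `x ∈ |S|_δ` to `ℝ^{δ+1}` given by the barycentric
coordinates of `x` with respect to the vertices of `|S|_δ`. -/
def IsLift (δ : ℕ) (S : Finset ℕ) (x : Fin δ → ℝ) (y : Fin (δ + 1) → ℝ) : Prop :=
  ∃ w : ℕ → ℝ, (∀ a ∈ S, 0 ≤ w a) ∧ (∑ a ∈ S, w a) = 1 ∧
    (∑ a ∈ S, w a • momCurve δ (a : ℝ)) = x ∧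
    (∑ a ∈ S, w a • momCurve (δ + 1) (a : ℝ)) = y

/-- `|A|_δ` is submerged by the triangulation `T`. -/
def Submerged (δ : ℕ) (T : Finset (Finset ℕ)) (A : Finset ℕ) : Prop :=
  ∀ S ∈ T, ∀ x ∈ smp δ A ∩ smp δ S, ∀ y y' : Fin (δ + 1) → ℝ,
    IsLift δ A x y → IsLift δ S x y' → lastCoord y ≤ lastCoord y'

/-- `|A|_δ` is supermerged by the triangulation `T`. -/
def Supermerged (δ : ℕ) (T : Finset (Finset ℕ)) (A : Finset ℕ) : Prop :=
  ∀ S ∈ T, ∀ x ∈ smp δ A ∩ smp δ S, ∀ y y' : Fin (δ + 1) → ℝ,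
    IsLift δ A x y → IsLift δ S x y' → lastCoord y' ≤ lastCoord y

/-- The second higher Stasheff–Tamari order `T ≤₂ T'`. -/
def HST2 (δ : ℕ) (T T' : Finset (Finset ℕ)) : Prop :=
  ∀ S ∈ T, ∀ S' ∈ T', ∀ x ∈ smp δ S ∩ smp δ S', ∀ y y' : Fin (δ + 1) → ℝ,
    IsLift δ S x y → IsLift δ S' x y' → lastCoord y ≤ lastCoord y'

open scoped Classical in
/-- The lower triangulation of `C(m, δ)`: the collection of `(δ+1)`-element subsets `F` of
`{1, …, m}` such that `|F|_{δ+1}` is a lower facet of `C(m, δ+1)`. -/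
def lowerTriang (m δ : ℕ) : Finset (Finset ℕ) :=
  (Finset.Icc 1 m).powerset.filter (fun F => IsLowerFacet m (δ + 1) F)

open scoped Classical in
/-- The upper triangulation of `C(m, δ)`. -/
def upperTriang (m δ : ℕ) : Finset (Finset ℕ) :=
  (Finset.Icc 1 m).powerset.filter (fun F => IsUpperFacet m (δ + 1) F)

open scoped Classical in
/-- `L(H)`: the `(δ+1)`-element subsets `G` of `H` with `|G|_{δ+1}` a lower facet of the
simplex `|H|_{δ+1}`. -/
def LH (δ : ℕ) (H : Finset ℕ) : Finset (Finset ℕ) :=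
  (H.filter (fun c => IsLowerFacetOfSimplex (δ + 1) H c)).image (fun c => H.erase c)

open scoped Classical in
/-- `U(H)`: the `(δ+1)`-element subsets `G` of `H` with `|G|_{δ+1}` an upper facet of the
simplex `|H|_{δ+1}`. -/
def UH (δ : ℕ) (H : Finset ℕ) : Finset (Finset ℕ) :=
  (H.filter (fun c => IsUpperFacetOfSimplex (δ + 1) H c)).image (fun c => H.erase c)

lemma smp_mono {δ : ℕ} {A B : Finset ℕ} (h : A ⊆ B) : smp δ A ⊆ smp δ B :=
  convexHull_mono (Set.image_mono (by exact_mod_cast h))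

/-- Points of a simplex on the moment curve are convex combinations of its vertices, with the
weights extended by zero to any larger vertex set `X`. -/
lemma mem_smp_iff {δ : ℕ} {S X : Finset ℕ} (hS : S ⊆ X) {x : Fin δ → ℝ} :
    x ∈ smp δ S ↔ ∃ w : ℕ → ℝ, (∀ i ∈ X, 0 ≤ w i) ∧ (∀ i ∈ X, i ∉ S → w i = 0) ∧
      ∑ i ∈ X, w i = 1 ∧ ∑ i ∈ X, w i • momCurve δ (i : ℝ) = x := by
  constructor
  · intro hx
    refine convexHull_min (t := {x | ∃ w : ℕ → ℝ, (∀ i ∈ X, 0 ≤ w i) ∧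
      (∀ i ∈ X, i ∉ S → w i = 0) ∧ ∑ i ∈ X, w i = 1 ∧
      ∑ i ∈ X, w i • momCurve δ (i : ℝ) = x}) ?_ ?_ hx
    · rintro _ ⟨a, ha, rfl⟩
      have ha' : a ∈ S := by simpa using ha
      refine ⟨fun i => if i = a then 1 else 0, fun i _ => by positivity, fun i _ hi => ?_, ?_, ?_⟩
      · exact if_neg fun (h : i = a) => hi (by rwa [h])
      · simp [hS ha']
      · simp [hS ha']
    · rintro _ ⟨u, hu0, huS, hu1, rfl⟩ _ ⟨v, hv0, hvS, hv1, rfl⟩ a b ha hb hab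
      refine ⟨fun i => a * u i + b * v i, fun i hi => ?_, fun i hi hiS => ?_, ?_, ?_⟩
      · have := hu0 i hi
        have := hv0 i hi
        positivity
      · simp [huS i hi hiS, hvS i hi hiS]
      · rw [sum_add_distrib, ← mul_sum, ← mul_sum, hu1, hv1]
        linarith
      · simp only [add_smul, sum_add_distrib, smul_sum, mul_smul]
  · rintro ⟨w, h0, hz, h1, rfl⟩
    rw [← sum_subset hS fun i hi hiS => by rw [hz i hi hiS, zero_smul]]
    rw [← sum_subset hS hz] at h1
    exact (convex_convexHull ℝ _).sum_mem (fun i hi => h0 i (hS hi)) h1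
      fun i hi => subset_convexHull ℝ _ ⟨i, hi, rfl⟩

lemma mem_affineSpan_momPts_iff {δ : ℕ} {S X : Finset ℕ} (hS : S ⊆ X) {x : Fin δ → ℝ} :
    x ∈ affineSpan ℝ (momPts δ S) ↔ ∃ w : ℕ → ℝ, (∀ i ∈ X, i ∉ S → w i = 0) ∧
      ∑ i ∈ X, w i = 1 ∧ ∑ i ∈ X, w i • momCurve δ (i : ℝ) = x := by
  constructor
  · intro hx
    obtain ⟨A, w, hA, hw, rfl⟩ := eq_affineCombination_of_mem_affineSpan_image hx
    rw [affineCombination_eq_linear_combination _ _ _ hw]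
    have hAS : A ⊆ S := by exact_mod_cast hA
    refine ⟨fun i => if i ∈ A then w i else 0, fun i _ hi => if_neg fun h => hi (hAS h), ?_, ?_⟩
    · rw [sum_ite_mem, inter_eq_right.2 (hAS.trans hS), hw]
    · simp only [ite_smul, zero_smul]
      rw [sum_ite_mem, inter_eq_right.2 (hAS.trans hS)]
  · rintro ⟨w, hz, h1, rfl⟩
    rw [← affineCombination_eq_linear_combination _ _ _ h1]
    exact affineCombination_mem_affineSpan_image h1 (by simpa using hz) _

/-- A `(δ+1)`-subset of `{1, …, δ+2}` omits exactly one index. -/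
lemma exists_erase_eq {δ : ℕ} {S : Finset ℕ} (hS : S ⊆ Icc 1 (δ + 2)) (hcard : S.card = δ + 1) :
    ∃ i ∈ Icc 1 (δ + 2), (Icc 1 (δ + 2)).erase i = S := by
  obtain ⟨i, hi, h⟩ := exists_eq_insert_iff.2 ⟨hS, by simp [hcard]⟩
  exact ⟨i, by simp [← h], by rw [← h, erase_insert hi]⟩

/-- The coefficients of an affine dependence between `p_δ(1), …, p_δ(δ+2)`: up to a scalar it is
the only one, and it involves all the points. -/
structure IsCircuit (δ : ℕ) (c : ℕ → ℝ) : Prop where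
  ne_zero : ∀ i ∈ Icc 1 (δ + 2), c i ≠ 0
  sum_eq_zero : ∑ i ∈ Icc 1 (δ + 2), c i = 0
  sum_smul_eq_zero : ∑ i ∈ Icc 1 (δ + 2), c i • momCurve δ (i : ℝ) = 0
  exists_eq_mul : ∀ w : ℕ → ℝ, ∑ i ∈ Icc 1 (δ + 2), w i = 0 →
    ∑ i ∈ Icc 1 (δ + 2), w i • momCurve δ (i : ℝ) = 0 → ∃ t, ∀ i ∈ Icc 1 (δ + 2), w i = t * c i

/-- The `(δ+1)`-subsets of `{1, …, δ+2}` omitting an index at which `c` is positive. -/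
def omitPos (δ : ℕ) (c : ℕ → ℝ) : Finset (Finset ℕ) :=
  ((Icc 1 (δ + 2)).filter fun i => 0 < c i).image fun i => (Icc 1 (δ + 2)).erase i

lemma mem_omitPos {δ : ℕ} {c : ℕ → ℝ} {S : Finset ℕ} :
    S ∈ omitPos δ c ↔ ∃ i ∈ Icc 1 (δ + 2), 0 < c i ∧ (Icc 1 (δ + 2)).erase i = S := by
  simp [omitPos, and_assoc]

namespace IsCircuit

variable {δ : ℕ} {c : ℕ → ℝ}

lemma neg (hc : IsCircuit δ c) : IsCircuit δ (-c) where
  ne_zero i hi := neg_ne_zero.2 (hc.ne_zero i hi)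
  sum_eq_zero := by simp [hc.sum_eq_zero]
  sum_smul_eq_zero := by simp [hc.sum_smul_eq_zero]
  exists_eq_mul w h0 h1 := by
    obtain ⟨t, ht⟩ := hc.exists_eq_mul w h0 h1
    exact ⟨-t, fun i hi => by simp [ht i hi]⟩

lemma exists_sub_eq_mul (hc : IsCircuit δ c) {u v : ℕ → ℝ}
    (h : ∑ i ∈ Icc 1 (δ + 2), u i = ∑ i ∈ Icc 1 (δ + 2), v i)
    (h' : ∑ i ∈ Icc 1 (δ + 2), u i • momCurve δ (i : ℝ) =
      ∑ i ∈ Icc 1 (δ + 2), v i • momCurve δ (i : ℝ)) :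
    ∃ t, ∀ i ∈ Icc 1 (δ + 2), u i - v i = t * c i :=
  hc.exists_eq_mul (fun i => u i - v i) (by rw [sum_sub_distrib, h, sub_self])
    (by simp only [sub_smul, sum_sub_distrib, h', sub_self])

lemma exists_pos (hc : IsCircuit δ c) : ∃ i ∈ Icc 1 (δ + 2), 0 < c i :=
  exists_pos_of_sum_zero_of_exists_nonzero c hc.sum_eq_zero
    ⟨1, by simp, hc.ne_zero 1 (by simp)⟩

lemma isTriangulation_omitPos (hc : IsCircuit δ c) : IsTriangulation (δ + 2) δ (omitPos δ c) := by
  refine ⟨fun S hS => ?_, ?_, fun S hS S' hS' => ?_⟩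
  · obtain ⟨i, hi, -, rfl⟩ := mem_omitPos.1 hS
    exact ⟨erase_subset _ _, by rw [card_erase_of_mem hi]; simp⟩
  · apply Set.Subset.antisymm
    · refine Set.iUnion₂_subset fun S hS => smp_mono ?_
      obtain ⟨i, hi, -, rfl⟩ := mem_omitPos.1 hS
      exact erase_subset _ _
    · intro x hx
      obtain ⟨w, hw0, -, hw1, hwx⟩ := (mem_smp_iff subset_rfl).1 hx
      obtain ⟨k, hk, hkc⟩ := hc.exists_pos
      obtain ⟨i, hi, hmin⟩ := exists_min_image ((Icc 1 (δ + 2)).filter fun i => 0 < c i)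
        (fun i => w i / c i) ⟨k, by simpa [hkc] using hk⟩
      obtain ⟨hiX, hic⟩ := mem_filter.1 hi
      have ht : 0 ≤ w i / c i := div_nonneg (hw0 i hiX) hic.le
      refine Set.mem_iUnion₂.2 ⟨_, mem_omitPos.2 ⟨i, hiX, hic, rfl⟩,
        (mem_smp_iff (erase_subset _ _)).2 ⟨fun j => w j - w i / c i * c j, fun j hj => ?_,
          fun j hj hji => ?_, ?_, ?_⟩⟩
      · rcases lt_or_ge 0 (c j) with hcj | hcj
        · have := (le_div_iff₀ hcj).1 (hmin j (mem_filter.2 ⟨hj, hcj⟩))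
          exact sub_nonneg.2 this
        · have := mul_nonpos_of_nonneg_of_nonpos ht hcj
          have := hw0 j hj
          simp only
          linarith
      · obtain rfl : j = i := by simpa [hj] using hji
        simp [hic.ne']
      · rw [sum_sub_distrib, ← mul_sum, hc.sum_eq_zero, hw1]
        simp
      · simp only [sub_smul, sum_sub_distrib, mul_smul, ← smul_sum, hc.sum_smul_eq_zero, hwx]
        simp
  · obtain ⟨i, hi, hci, rfl⟩ := mem_omitPos.1 hS
    obtain ⟨j, hj, hcj, rfl⟩ := mem_omitPos.1 hS'
    refine Set.Subset.antisymm ?_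
      (Set.subset_inter (smp_mono inter_subset_left) (smp_mono inter_subset_right))
    rintro x ⟨hx, hx'⟩
    obtain ⟨u, hu0, huS, hu1, hux⟩ := (mem_smp_iff (erase_subset _ _)).1 hx
    obtain ⟨v, hv0, hvS, hv1, hvx⟩ := (mem_smp_iff (erase_subset _ _)).1 hx'
    obtain ⟨t, ht⟩ := hc.exists_sub_eq_mul (hu1.trans hv1.symm) (hux.trans hvx.symm)
    have hui : u i = 0 := huS i hi (by simp)
    have hvj : v j = 0 := hvS j hj (by simp)
    have hX : (Icc 1 (δ + 2)).erase i ∩ (Icc 1 (δ + 2)).erase j ⊆ Icc 1 (δ + 2) :=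
      inter_subset_left.trans (erase_subset _ _)
    rcases le_total 0 t with h | h
    · refine (mem_smp_iff hX).2 ⟨v, hv0, fun k hk hkS => ?_, hv1, hvx⟩
      obtain rfl | rfl : k = i ∨ k = j := by
        by_contra! hne
        exact hkS (by simp_all)
      · have := ht k hk
        have := mul_nonneg h hci.le
        have := hv0 k hk
        linarith
      · exact hvj
    · refine (mem_smp_iff hX).2 ⟨u, hu0, fun k hk hkS => ?_, hu1, hux⟩
      obtain rfl | rfl : k = i ∨ k = j := by
        by_contra! hne
        exact hkS (by simp_all)
      · exact hui
      · have := ht k hk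
        have := mul_nonpos_of_nonpos_of_nonneg h hcj.le
        have := hu0 k hk
        linarith

/-- The Radon point of `p_δ(1), …, p_δ(δ+2)` prevents simplices omitting indices of opposite
sign from meeting in a common face. -/
lemma smp_erase_inter_ne (hc : IsCircuit δ c) {i j : ℕ} (hi : i ∈ Icc 1 (δ + 2))
    (hj : j ∈ Icc 1 (δ + 2)) (hci : 0 < c i) (hcj : c j < 0) :
    smp δ ((Icc 1 (δ + 2)).erase i) ∩ smp δ ((Icc 1 (δ + 2)).erase j) ≠
      smp δ ((Icc 1 (δ + 2)).erase i ∩ (Icc 1 (δ + 2)).erase j) := by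
  intro h
  set C := ∑ k ∈ Icc 1 (δ + 2), max (c k) 0 with hC
  have hCpos : 0 < C := sum_pos' (fun k _ => le_max_right _ _) ⟨i, hi, by simpa using hci⟩
  have hsplit : ∀ k, max (c k) 0 / C = max (-c k) 0 / C + C⁻¹ * c k := fun k => by
    rcases le_total 0 (c k) with h | h
    · simp [h]
      field_simp
    · simp [h]
      field_simp
      ring
  have hpos1 : ∑ k ∈ Icc 1 (δ + 2), max (c k) 0 / C = 1 := by
    rw [← sum_div, ← hC, div_self hCpos.ne']
  have hneg1 : ∑ k ∈ Icc 1 (δ + 2), max (-c k) 0 / C = 1 := by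
    rw [← hpos1, sum_congr rfl fun k _ => hsplit k, sum_add_distrib, ← mul_sum,
      hc.sum_eq_zero]
    simp
  obtain ⟨x, hx⟩ : ∃ x, ∑ k ∈ Icc 1 (δ + 2), (max (c k) 0 / C) • momCurve δ (k : ℝ) = x :=
    ⟨_, rfl⟩
  have hx' : ∑ k ∈ Icc 1 (δ + 2), (max (-c k) 0 / C) • momCurve δ (k : ℝ) = x := by
    rw [← hx]
    simp only [hsplit, add_smul, mul_smul, sum_add_distrib, ← smul_sum, hc.sum_smul_eq_zero]
    simp
  have hxi : x ∈ smp δ ((Icc 1 (δ + 2)).erase i) := by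
    refine (mem_smp_iff (erase_subset _ _)).2 ⟨_, fun k _ => by positivity, fun k hk hki => ?_,
      hneg1, hx'⟩
    obtain rfl : k = i := by simpa [hk] using hki
    simp [hci.le]
  have hxj : x ∈ smp δ ((Icc 1 (δ + 2)).erase j) := by
    refine (mem_smp_iff (erase_subset _ _)).2 ⟨_, fun k _ => by positivity, fun k hk hkj => ?_,
      hpos1, hx⟩
    obtain rfl : k = j := by simpa [hk] using hkj
    simp [hcj.le]
  obtain ⟨u, -, hu, hu1, hux⟩ := (mem_smp_iff (inter_subset_left.trans (erase_subset _ _))).1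
    (h ▸ ⟨hxi, hxj⟩ : x ∈ smp δ ((Icc 1 (δ + 2)).erase i ∩ (Icc 1 (δ + 2)).erase j))
  obtain ⟨t, ht⟩ := hc.exists_sub_eq_mul (hpos1.trans hu1.symm) (hx.trans hux.symm)
  have hti := ht i hi
  have htj := ht j hj
  rw [hu i hi (by simp), max_eq_left hci.le] at hti
  rw [hu j hj (by simp), max_eq_right hcj.le] at htj
  have ht0 : t = 0 := by
    have : t * c j = 0 := by rw [← htj]; simp
    exact (mul_eq_zero.1 this).resolve_right hcj.ne
  rw [ht0, sub_zero, zero_mul] at hti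
  linarith [div_pos hci hCpos]

/-- No proper subset of `omitPos δ c` covers the cyclic polytope. -/
lemma eq_omitPos_of_subset (hc : IsCircuit δ c) {T : Finset (Finset ℕ)}
    (hT : IsTriangulation (δ + 2) δ T) (hsub : T ⊆ omitPos δ c) : T = omitPos δ c := by
  refine hsub.antisymm fun S hS => ?_
  obtain ⟨i, hi, hci, rfl⟩ := mem_omitPos.1 hS
  have hcard : ((Icc 1 (δ + 2)).erase i).card = δ + 1 := by rw [card_erase_of_mem hi]; simp
  let w : ℕ → ℝ := fun k => if k = i then 0 else ((δ : ℝ) + 1)⁻¹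
  have hw1 : ∑ k ∈ Icc 1 (δ + 2), w k = 1 := by
    rw [← add_sum_erase _ _ hi, sum_congr rfl fun k hk => if_neg (ne_of_mem_erase hk)]
    simp only [sum_const, hcard, w]
    simp
    field_simp
  have hx : ∑ k ∈ Icc 1 (δ + 2), w k • momCurve δ (k : ℝ) ∈ cyc (δ + 2) δ :=
    (mem_smp_iff subset_rfl).2 ⟨w, fun k _ => by simp only [w]; positivity,
      fun k hk hk' => absurd hk hk', hw1, rfl⟩
  rw [← hT.2.1] at hx
  obtain ⟨S, hST, hxS⟩ := Set.mem_iUnion₂.1 hx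
  obtain ⟨j, hj, hcj, rfl⟩ := mem_omitPos.1 (hsub hST)
  obtain rfl | hij := eq_or_ne j i
  · exact hST
  obtain ⟨v, hv0, hv, hv1, hvx⟩ := (mem_smp_iff (erase_subset _ _)).1 hxS
  obtain ⟨t, ht⟩ := hc.exists_sub_eq_mul (hw1.trans hv1.symm) hvx.symm
  have htj := ht j hj
  have hti := ht i hi
  simp only [hv j hj (by simp), w, if_neg hij, sub_zero] at htj
  simp only [w, if_true, zero_sub] at hti
  have htpos : 0 < t := pos_of_mul_pos_left (by rw [← htj]; positivity) hcj.le
  have := mul_pos htpos hci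
  have := hv0 i hi
  linarith

lemma eq_omitPos_or_eq (hc : IsCircuit δ c) {T : Finset (Finset ℕ)}
    (hT : IsTriangulation (δ + 2) δ T) : T = omitPos δ c ∨ T = omitPos δ (-c) := by
  by_cases hpos : T ⊆ omitPos δ c
  · exact Or.inl (hc.eq_omitPos_of_subset hT hpos)
  refine Or.inr (hc.neg.eq_omitPos_of_subset hT fun S hS => ?_)
  obtain ⟨S', hS', hS'pos⟩ := not_subset.1 hpos
  obtain ⟨i, hi, rfl⟩ := exists_erase_eq (hT.1 S hS).1 (hT.1 S hS).2
  obtain ⟨j, hj, rfl⟩ := exists_erase_eq (hT.1 S' hS').1 (hT.1 S' hS').2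
  have hcj : c j < 0 := lt_of_le_of_ne
    (not_lt.1 fun h => hS'pos (mem_omitPos.2 ⟨j, hj, h, rfl⟩)) (hc.ne_zero j hj)
  refine mem_omitPos.2 ⟨i, hi, neg_pos.2 (lt_of_le_of_ne (not_lt.1 fun hci => ?_)
    (hc.ne_zero i hi)), rfl⟩
  exact hc.smp_erase_inter_ne hi hj hci hcj (hT.2.2 _ hS _ hS')

lemma omitPos_ne (hc : IsCircuit δ c) : omitPos δ c ≠ omitPos δ (-c) := by
  intro h
  obtain ⟨i, hi, hci⟩ := hc.exists_pos
  obtain ⟨j, -, hcj, hij⟩ := mem_omitPos.1 (h ▸ mem_omitPos.2 ⟨i, hi, hci, rfl⟩)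
  obtain rfl : i = j := by
    by_contra hne
    exact notMem_erase i _ (hij ▸ mem_erase.2 ⟨hne, hi⟩)
  simp only [Pi.neg_apply] at hcj
  linarith

end IsCircuit

/-- The coefficients of the affine dependence between `p_δ(1), …, p_δ(δ+2)` given by the
`(δ+1)`-st finite difference. -/
def diffCoeff (δ i : ℕ) : ℝ := (-1) ^ (δ + 1 - (i - 1)) * (δ + 1).choose (i - 1)

lemma sum_Icc_one_eq_sum_range (f : ℕ → ℝ) (n : ℕ) :
    ∑ i ∈ Icc 1 n, f i = ∑ j ∈ range n, f (j + 1) := by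
  rw [range_eq_Ico, sum_Ico_add', zero_add]
  rfl

lemma sum_diffCoeff_mul (δ k : ℕ) :
    ∑ i ∈ Icc 1 (δ + 2), diffCoeff δ i * (i : ℝ) ^ k =
      (fwdDiff 1)^[δ + 1] (fun r : ℝ => r ^ k) 1 := by
  rw [fwdDiff_iter_eq_sum_shift, sum_Icc_one_eq_sum_range]
  refine sum_congr rfl fun j _ => ?_
  simp [diffCoeff, add_comm]

lemma sum_diffCoeff_mul_pow_eq_zero {δ k : ℕ} (hk : k ≤ δ) :
    ∑ i ∈ Icc 1 (δ + 2), diffCoeff δ i * (i : ℝ) ^ k = 0 := by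
  rw [sum_diffCoeff_mul, fwdDiff_iter_pow_eq_zero_of_lt (Nat.lt_succ_of_le hk)]
  rfl

lemma sum_diffCoeff_mul_pow_pos (δ : ℕ) :
    0 < ∑ i ∈ Icc 1 (δ + 2), diffCoeff δ i * (i : ℝ) ^ (δ + 1) := by
  rw [sum_diffCoeff_mul, fwdDiff_iter_eq_factorial]
  simp [Nat.factorial_pos]

lemma sum_smul_momCurve_apply {δ : ℕ} (X : Finset ℕ) (w : ℕ → ℝ) (k : Fin δ) :
    (∑ i ∈ X, w i • momCurve δ (i : ℝ)) k = ∑ i ∈ X, w i * (i : ℝ) ^ (k.1 + 1) := by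
  simp [momCurve]

/-- Invertibility of the Vandermonde matrix on the nodes `1, …, n`. -/
lemma eq_zero_of_sum_mul_pow_eq_zero {n : ℕ} {w : ℕ → ℝ}
    (h : ∀ k < n, ∑ i ∈ Icc 1 n, w i * (i : ℝ) ^ k = 0) {i : ℕ} (hi : i ∈ Icc 1 n) :
    w i = 0 := by
  have hv : (fun j : Fin n => w (j + 1)) = 0 := by
    refine Matrix.eq_zero_of_forall_pow_sum_mul_pow_eq_zero (f := fun j : Fin n => ((j + 1 : ℕ) : ℝ))
      (fun a b hab => by simpa [Fin.ext_iff] using hab) fun k => ?_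
    rw [← h k k.2, sum_Icc_one_eq_sum_range,
      Fin.sum_univ_eq_sum_range (fun j => w (j + 1) * ((j + 1 : ℕ) : ℝ) ^ (k : ℕ))]
  obtain ⟨h1, h2⟩ := mem_Icc.1 hi
  have := congrFun hv ⟨i - 1, by omega⟩
  simpa [Nat.sub_add_cancel h1] using this

lemma isCircuit_diffCoeff (δ : ℕ) : IsCircuit δ (diffCoeff δ) where
  ne_zero i hi := by
    have : (δ + 1).choose (i - 1) ≠ 0 := Nat.choose_ne_zero (by simp at hi; omega)
    simp [diffCoeff, this]
  sum_eq_zero := by simpa using sum_diffCoeff_mul_pow_eq_zero (Nat.zero_le δ)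
  sum_smul_eq_zero := by
    ext k
    rw [sum_smul_momCurve_apply, sum_diffCoeff_mul_pow_eq_zero k.2]
    rfl
  exists_eq_mul w h0 h1 := by
    have hD := sum_diffCoeff_mul_pow_pos δ
    set D := ∑ i ∈ Icc 1 (δ + 2), diffCoeff δ i * (i : ℝ) ^ (δ + 1)
    set t := (∑ i ∈ Icc 1 (δ + 2), w i * (i : ℝ) ^ (δ + 1)) / D with ht
    refine ⟨t, fun i hi => sub_eq_zero.1 (eq_zero_of_sum_mul_pow_eq_zero
      (w := fun i => w i - t * diffCoeff δ i) (fun k hk => ?_) hi)⟩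
    simp only [sub_mul, sum_sub_distrib, mul_assoc, ← mul_sum]
    rcases Nat.lt_succ_iff_lt_or_eq.1 hk with hk | rfl
    · rw [sum_diffCoeff_mul_pow_eq_zero (Nat.le_of_lt_succ hk), mul_zero, sub_zero]
      rcases k with _ | k
      · simpa using h0
      · simpa [momCurve] using congrFun h1 ⟨k, by omega⟩
    · rw [ht, div_mul_cancel₀ _ hD.ne', sub_self]

lemma eLast_succ_apply {δ : ℕ} (k : Fin (δ + 1)) :
    eLast (δ + 1) k = if k.1 = δ then 1 else 0 := by
  simp [eLast]

/-- The height of `p_{δ+1}(i)` over the hyperplane through the other points of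
`p_{δ+1}(1), …, p_{δ+1}(δ+2)` is determined by the coefficient of `i`. -/
lemma sub_smul_eLast_mem_affineSpan_iff {δ i : ℕ} (hi : i ∈ Icc 1 (δ + 2)) (r : ℝ) :
    momCurve (δ + 1) (i : ℝ) - r • eLast (δ + 1) ∈
        affineSpan ℝ (momPts (δ + 1) ((Icc 1 (δ + 2)).erase i)) ↔
      r * diffCoeff δ i = ∑ j ∈ Icc 1 (δ + 2), diffCoeff δ j * (j : ℝ) ^ (δ + 1) := by
  have hc := isCircuit_diffCoeff δ
  have hci := hc.ne_zero i hi
  rw [mem_affineSpan_momPts_iff (erase_subset i _)]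
  constructor
  · rintro ⟨w, hw, hw1, hwx⟩
    have hmom : ∀ k : Fin (δ + 1), ∑ j ∈ Icc 1 (δ + 2), w j * (j : ℝ) ^ (k.1 + 1) =
        (i : ℝ) ^ (k.1 + 1) - r * if k.1 = δ then 1 else 0 := fun k => by
      rw [← sum_smul_momCurve_apply, hwx, ← eLast_succ_apply]
      rfl
    obtain ⟨t, ht⟩ := hc.exists_sub_eq_mul (u := fun j => if j = i then 1 else 0) (v := w)
      (by rw [hw1, sum_ite_eq' _ i, if_pos hi]) (by
        ext k
        have hk := hmom k.castSucc
        rw [Fin.val_castSucc, if_neg k.2.ne, mul_zero, sub_zero] at hk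
        simp only [sum_smul_momCurve_apply, hk, ite_mul, one_mul, zero_mul, sum_ite_eq', if_pos hi])
    have hti := ht i hi
    rw [if_pos rfl, hw i hi (by simp), sub_zero] at hti
    have htop := hmom (Fin.last δ)
    rw [sum_congr rfl fun j hj => by rw [← sub_sub_cancel (if j = i then 1 else 0) (w j), ht j hj]]
      at htop
    simp only [sub_mul, sum_sub_distrib, ite_mul, one_mul, zero_mul, sum_ite_eq', if_pos hi,
      Fin.val_last, if_true, mul_one, mul_assoc, ← mul_sum] at htop
    rw [← sub_right_inj.1 htop, mul_right_comm, ← hti, one_mul]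
  · intro hr
    refine ⟨fun j => (if j = i then 1 else 0) - (diffCoeff δ i)⁻¹ * diffCoeff δ j,
      fun j hj hji => ?_, ?_, ?_⟩
    · obtain rfl : j = i := by simpa [hj] using hji
      simp [hci]
    · rw [sum_sub_distrib, ← mul_sum, hc.sum_eq_zero, sum_ite_eq' _ i, if_pos hi]
      simp
    · ext k
      rw [sum_smul_momCurve_apply]
      simp only [sub_mul, sum_sub_distrib, ite_mul, one_mul, zero_mul, sum_ite_eq', if_pos hi,
        mul_assoc, ← mul_sum, Pi.sub_apply, Pi.smul_apply, eLast_succ_apply, smul_eq_mul]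
      rcases Nat.lt_succ_iff_lt_or_eq.1 k.2 with hk | hk
      · rw [sum_diffCoeff_mul_pow_eq_zero hk, if_neg hk.ne]
        simp [momCurve]
      · rw [hk, ← hr, if_pos rfl, mul_comm r, inv_mul_cancel_left₀ hci]
        simp [momCurve, hk]

lemma strictlyAbove_affineSpan_iff {δ i : ℕ} (hi : i ∈ Icc 1 (δ + 2)) :
    StrictlyAbove (momCurve (δ + 1) (i : ℝ))
        (affineSpan ℝ (momPts (δ + 1) ((Icc 1 (δ + 2)).erase i)) : Set (Fin (δ + 1) → ℝ)) ↔
      0 < diffCoeff δ i := by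
  have hD := sum_diffCoeff_mul_pow_pos δ
  simp only [StrictlyAbove, SetLike.mem_coe, sub_smul_eLast_mem_affineSpan_iff hi]
  refine ⟨fun ⟨r, hr, h⟩ => pos_of_mul_pos_right (h ▸ hD) hr.le, fun h => ⟨_, div_pos hD h, ?_⟩⟩
  rw [div_mul_cancel₀ _ h.ne']

lemma strictlyBelow_affineSpan_iff {δ i : ℕ} (hi : i ∈ Icc 1 (δ + 2)) :
    StrictlyBelow (momCurve (δ + 1) (i : ℝ))
        (affineSpan ℝ (momPts (δ + 1) ((Icc 1 (δ + 2)).erase i)) : Set (Fin (δ + 1) → ℝ)) ↔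
      0 < (-diffCoeff δ) i := by
  have hD := sum_diffCoeff_mul_pow_pos δ
  simp only [StrictlyBelow, SetLike.mem_coe, sub_smul_eLast_mem_affineSpan_iff hi, Pi.neg_apply,
    neg_pos]
  refine ⟨fun ⟨r, hr, h⟩ => neg_of_mul_pos_right (h ▸ hD) hr.le,
    fun h => ⟨_, div_neg_of_pos_of_neg hD h, ?_⟩⟩
  rw [div_mul_cancel₀ _ h.ne]

/-- Collections of `(δ+1)`-subsets of `{1, …, δ+2}` described by a condition on omitted indices. -/
lemma mem_omitPos_iff_forall {δ : ℕ} {c : ℕ → ℝ} {P : ℕ → Finset ℕ → Prop}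
    (hP : ∀ i ∈ Icc 1 (δ + 2), P i ((Icc 1 (δ + 2)).erase i) ↔ 0 < c i) (F : Finset ℕ) :
    F ∈ omitPos δ c ↔ F ⊆ Icc 1 (δ + 2) ∧ F.card = δ + 1 ∧
      ∀ i ∈ Icc 1 (δ + 2), i ∉ F → P i F := by
  constructor
  · intro hF
    obtain ⟨i, hi, hci, rfl⟩ := mem_omitPos.1 hF
    refine ⟨erase_subset _ _, by rw [card_erase_of_mem hi]; simp, fun j hj hji => ?_⟩
    obtain rfl : j = i := by
      by_contra hne
      exact hji (mem_erase.2 ⟨hne, hj⟩)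
    exact (hP j hj).2 hci
  · rintro ⟨hF, hcard, h⟩
    obtain ⟨i, hi, rfl⟩ := exists_erase_eq hF hcard
    exact mem_omitPos.2 ⟨i, hi, (hP i hi).1 (h i hi (notMem_erase i _)), rfl⟩

lemma lowerTriang_eq (δ : ℕ) : lowerTriang (δ + 2) δ = omitPos δ (diffCoeff δ) := by
  ext F
  rw [mem_omitPos_iff_forall (P := fun i F => StrictlyAbove (momCurve (δ + 1) (i : ℝ))
    (affineSpan ℝ (momPts (δ + 1) F))) fun _ hi => strictlyAbove_affineSpan_iff hi,
    lowerTriang]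
  simp only [mem_filter, mem_powerset]
  exact and_iff_right_of_imp And.left

lemma upperTriang_eq (δ : ℕ) : upperTriang (δ + 2) δ = omitPos δ (-diffCoeff δ) := by
  ext F
  rw [mem_omitPos_iff_forall (P := fun i F => StrictlyBelow (momCurve (δ + 1) (i : ℝ))
    (affineSpan ℝ (momPts (δ + 1) F))) fun _ hi => strictlyBelow_affineSpan_iff hi,
    upperTriang]
  simp only [mem_filter, mem_powerset]
  exact and_iff_right_of_imp And.left

/-- `C(δ+2, δ)` has exactly two triangulations, namely its lower and its
upper triangulation, and these are distinct. -/
theorem statement9 (δ : ℕ) (hδ : 1 ≤ δ) :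
    IsTriangulation (δ + 2) δ (lowerTriang (δ + 2) δ) ∧
    IsTriangulation (δ + 2) δ (upperTriang (δ + 2) δ) ∧
    lowerTriang (δ + 2) δ ≠ upperTriang (δ + 2) δ ∧
    ∀ T : Finset (Finset ℕ), IsTriangulation (δ + 2) δ T →
      T = lowerTriang (δ + 2) δ ∨ T = upperTriang (δ + 2) δ := by
  have hc := isCircuit_diffCoeff δ
  rw [lowerTriang_eq, upperTriang_eq]
  exact ⟨hc.isTriangulation_omitPos, hc.neg.isTriangulation_omitPos, hc.omitPos_ne,
    fun _ hT => hc.eq_omitPos_or_eq hT⟩
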